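/- For every t > 0, the derivative of the Lyapunov function satisfies the differential inequality d/dt L(t) ≤ (2/η) ρ_min v'_max L(t), where the right-hand side is nonpositive since v'_max < 0 and ρ_min > 0. -/

import Mathlib

open MeasureTheory intervalIntegral Set

/-- Differentiation under an interval integral whose integrand has a jointly continuous partial
derivative in the parameter. -/
theorem hasDerivAt_intervalIntegral_of_continuousOn {F F' : ℝ → ℝ → ℝ} {s : Set ℝ} (hs : IsOpen s)
    {a b t : ℝ} (ht : t ∈ s) (hF : ∀ τ ∈ s, ContinuousOn (F τ) (uIcc a b))
    (hF' : ContinuousOn (fun p : ℝ × ℝ => F' p.1 p.2) (s ×ˢ uIcc a b))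
    (hd : ∀ τ ∈ s, ∀ x ∈ uIcc a b, HasDerivAt (fun τ => F τ x) (F' τ x) τ) :
    HasDerivAt (fun τ => ∫ x in a..b, F τ x) (∫ x in a..b, F' t x) t := by
  obtain ⟨ε, hε, hball⟩ := Metric.nhds_basis_closedBall.mem_iff.1 (hs.mem_nhds ht)
  obtain ⟨C, hC⟩ := ((isCompact_closedBall t ε).prod (isCompact_uIcc (a := a) (b := b))
    ).exists_bound_of_continuousOn (hF'.mono (prod_mono_left hball))
  have hmeas : ∀ f : ℝ → ℝ, ContinuousOn f (uIcc a b) →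
      AEStronglyMeasurable f (volume.restrict (uIoc a b)) := fun f hf =>
    (hf.mono uIoc_subset_uIcc).aestronglyMeasurable measurableSet_uIoc
  have hslice : ContinuousOn (F' t) (uIcc a b) :=
    hF'.comp (f := fun x => (t, x)) (by fun_prop) fun x hx => ⟨ht, hx⟩
  refine (hasDerivAt_integral_of_dominated_loc_of_deriv_le (bound := fun _ => C)
    (Metric.closedBall_mem_nhds t hε) ?_ (hF t ht).intervalIntegrable (hmeas _ hslice) ?_
    (by simp) ?_).2
  · filter_upwards [hs.mem_nhds ht] with τ hτ using hmeas _ (hF τ hτ)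
  · exact .of_forall fun x hx τ hτ => hC (τ, x) ⟨hτ, uIoc_subset_uIcc hx⟩
  · exact .of_forall fun x hx τ hτ => hd τ (hball hτ) x (uIoc_subset_uIcc hx)

/-- The forward average of a function over a window of length `η`, written on a fixed window. -/
theorem forward_average_eq (f : ℝ → ℝ) (x η : ℝ) :
    ∫ y in x..(x + η), f y = ∫ z in (0 : ℝ)..η, f (x + z) := by
  simp

/-- The forward average of a continuous function is differentiable. -/
theorem differentiable_forward_average {f : ℝ → ℝ} (hf : Continuous f)
    (x η : ℝ) : DifferentiableAt ℝ (fun x => ∫ y in x..(x + η), f y) x := by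
  have h : (fun x => ∫ y in x..(x + η), f y)
      = fun x => (∫ y in (0 : ℝ)..(x + η), f y) - ∫ y in (0 : ℝ)..x, f y := by
    funext x
    rw [integral_interval_sub_left] <;> exact hf.intervalIntegrable _ _
  have hd : Differentiable ℝ fun x => ∫ y in (0 : ℝ)..x, f y := fun x =>
    (hf.integral_hasStrictDerivAt 0 x).hasDerivAt.differentiableAt
  rw [h]
  exact ((hd (x + η)).comp x (by fun_prop : DifferentiableAt ℝ (fun x => x + η) x)).sub (hd x)

/-- A forward average of a function with values in `[m, M]` lies in `[m, M]`. -/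
theorem forward_average_mem_Icc {f : ℝ → ℝ} (hf : Continuous f) {m M η : ℝ} (hη : 0 < η)
    (h : ∀ x, f x ∈ Icc m M) (x : ℝ) : (1 / η) * ∫ y in x..(x + η), f y ∈ Icc m M := by
  have hle : x ≤ x + η := by linarith
  have h1 := integral_mono_on (μ := volume) hle (continuous_const.intervalIntegrable _ _)
    (hf.intervalIntegrable _ _) fun y _ => (h y).1
  have h2 := integral_mono_on (μ := volume) hle (hf.intervalIntegrable _ _)
    (continuous_const.intervalIntegrable _ _) fun y _ => (h y).2
  simp only [intervalIntegral.integral_const, add_sub_cancel_left, smul_eq_mul] at h1 h2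
  rw [one_div_mul_eq_div]
  exact ⟨(le_div_iff₀ hη).2 (by linarith), (div_le_iff₀ hη).2 (by linarith)⟩

/-- Along a line of speed `c`, the derivative of a moving forward average of a solution of
`∂ₜρ + ∂ₓ(ρ V) = 0`, on windows at whose right end the state is `r` and the velocity is `c`. -/
theorem hasDerivAt_moving_average {ρ V : ℝ → ℝ → ℝ} {η b c : ℝ}
    (hρ : ContDiffOn ℝ 1 (fun p : ℝ × ℝ => ρ p.1 p.2) (Ioi 0 ×ˢ univ))
    (hVd : ∀ t > 0, Differentiable ℝ (V t))
    (hpde : ∀ t > 0, ∀ x, deriv (fun s => ρ s x) t + deriv (fun y => ρ t y * V t y) x = 0)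
    {t y : ℝ} (ht : 0 < t) (hV : V t (b + c * t + y + η) = c) :
    HasDerivAt (fun s => ∫ z in (b + c * s + y)..(b + c * s + y + η), ρ s z)
      (ρ t (b + c * t + y) * (V t (b + c * t + y) - c)) t := by
  set P : ℝ × ℝ → ℝ := fun p => ρ p.1 p.2 with hP
  have hopen : IsOpen (Ioi (0 : ℝ) ×ˢ (univ : Set ℝ)) := isOpen_Ioi.prod isOpen_univ
  have hG : ContinuousOn (fderiv ℝ P) (Ioi 0 ×ˢ univ) :=
    hρ.continuousOn_fderiv_of_isOpen hopen le_rfl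
  have hPd : ∀ s > 0, ∀ x, HasFDerivAt P (fderiv ℝ P (s, x)) (s, x) := fun s hs x =>
    ((hρ.differentiableOn one_ne_zero).differentiableAt
      (hopen.mem_nhds (mk_mem_prod hs (mem_univ x)))).hasFDerivAt
  have hcurve : ∀ s > 0, ∀ x, HasDerivAt (fun s => ρ s (b + c * s + y + x))
      (fderiv ℝ P (s, b + c * s + y + x) (1, c)) s := by
    intro s hs x
    have hγ : HasDerivAt (fun s => (s, b + c * s + y + x)) ((1 : ℝ), c) s := by
      refine (hasDerivAt_id s).prodMk ?_
      simpa using ((((hasDerivAt_id s).const_mul c).const_add b).add_const y).add_const x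
    exact HasFDerivAt.comp_hasDerivAt (l := P) (f := fun s => (s, b + c * s + y + x)) s
      (hPd s hs _) hγ
  have hslice : ∀ s > 0, ∀ x, HasDerivAt (ρ s) (fderiv ℝ P (s, x) (0, 1)) x := fun s hs x =>
    HasFDerivAt.comp_hasDerivAt (l := P) (f := fun x => (s, x)) x (hPd s hs x)
      ((hasDerivAt_const x s).prodMk (hasDerivAt_id x))
  have htime : ∀ s > 0, ∀ x, HasDerivAt (fun s => ρ s x) (fderiv ℝ P (s, x) (1, 0)) s :=
    fun s hs x => HasFDerivAt.comp_hasDerivAt (l := P) (f := fun s => (s, x)) s (hPd s hs x)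
      ((hasDerivAt_id s).prodMk (hasDerivAt_const s x))
  have hcont : ∀ s > 0, Continuous (ρ s) := fun s hs =>
    continuous_iff_continuousAt.2 fun x => (hslice s hs x).continuousAt
  have key : HasDerivAt (fun s => ∫ z in (0 : ℝ)..η, ρ s (b + c * s + y + z))
      (∫ z in (0 : ℝ)..η, fderiv ℝ P (t, b + c * t + y + z) (1, c)) t := by
    refine hasDerivAt_intervalIntegral_of_continuousOn (s := Ioi 0)
      (F' := fun s z => fderiv ℝ P (s, b + c * s + y + z) (1, c)) isOpen_Ioi ht
      (fun s hs => ((hcont s hs).comp (by fun_prop)).continuousOn) ?_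
      (fun s hs z _ => hcurve s hs z)
    refine ContinuousOn.clm_apply (hG.comp (f := fun p : ℝ × ℝ => (p.1, b + c * p.1 + y + p.2))
      (by fun_prop) fun p hp => ⟨hp.1, mem_univ _⟩) continuousOn_const
  have hflux : ∀ x, HasDerivAt (fun x => c * ρ t x - ρ t x * V t x)
      (fderiv ℝ P (t, x) (1, c)) x := by
    intro x
    have h1 := (hslice t ht x).const_mul c
    have h2 := ((hslice t ht x).differentiableAt.fun_mul (hVd t ht x)).hasDerivAt
    have h3 := hpde t ht x
    rw [(htime t ht x).deriv] at h3
    have h4 : fderiv ℝ P (t, x) (1, c)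
        = fderiv ℝ P (t, x) (1, 0) + c * fderiv ℝ P (t, x) (0, 1) := by
      rw [← smul_eq_mul, ← map_smul, ← map_add]
      simp
    rw [h4, eq_neg_of_add_eq_zero_left h3, neg_add_eq_sub]
    exact h1.sub h2
  have hint : ∫ z in (0 : ℝ)..η, fderiv ℝ P (t, b + c * t + y + z) (1, c)
      = ρ t (b + c * t + y) * (V t (b + c * t + y) - c) := by
    rw [← forward_average_eq (fun x => fderiv ℝ P (t, x) (1, c)),
      integral_eq_sub_of_hasDerivAt (fun x _ => hflux x), hV]
    · ring
    · refine Continuous.intervalIntegrable ?_ _ _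
      have : Continuous fun x => fderiv ℝ P (t, x) := continuousOn_univ.1 <|
        hG.comp (f := fun x => (t, x)) (by fun_prop) fun x _ => ⟨ht, mem_univ _⟩
      exact this.clm_apply continuous_const
  simp only [forward_average_eq]
  exact hint ▸ key

/-- For every `t > 0`, the derivative of the Lyapunov function
satisfies the differential inequality `d/dt L(t) ≤ (2/η) ρ_min v'_max L(t)`, where the
right-hand side is nonpositive since `v'_max < 0` and `ρ_min > 0`. -/
theorem lyapunov_differential_inequality
    (η ρmax ρmin : ℝ) (hη : 0 < η) (hρmax : 0 < ρmax)
    (hρmin : 0 < ρmin) (hρminmax : ρmin ≤ ρmax)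
    (v : ℝ → ℝ) (hv : ContDiffOn ℝ 2 v (Set.Icc 0 ρmax))
    (v'max : ℝ) (hv'max : v'max < 0)
    (hv' : ∀ r ∈ Set.Icc (0 : ℝ) ρmax, deriv v r < 0)
    (hv'bound : ∀ r ∈ Set.Icc (0 : ℝ) ρmax, deriv v r ≤ v'max)
    (ρbar : ℝ) (hρbar : ρbar ∈ Set.Ioc 0 ρmax)
    (vbar b : ℝ) (hvbar : vbar = v ρbar)
    (β : ℝ → ℝ) (hβ : ∀ t, β t = b + vbar * t)
    (ρ : ℝ → ℝ → ℝ)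
    (hρreg : ContDiffOn ℝ 1 (fun p : ℝ × ℝ => ρ p.1 p.2) (Set.Ici 0 ×ˢ Set.univ))
    (hρrange : ∀ t ≥ (0 : ℝ), ∀ x, ρ t x ∈ Set.Icc ρmin ρmax)
    (hρeq : ∀ t ≥ (0 : ℝ), ∀ x, β t ≤ x → ρ t x = ρbar)
    (V : ℝ → ℝ → ℝ)
    (hV : ∀ t x, V t x = v ((1 / η) * ∫ y in x..(x + η), ρ t y))
    (hpde : ∀ t ≥ (0 : ℝ), ∀ x,
      derivWithin (fun s => ρ s x) (Set.Ici 0) t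
        + deriv (fun y => ρ t y * V t y) x = 0)
    (L : ℝ → ℝ)
    (hL : ∀ t, L t = ∫ x in (β t - η)..(β t), (V t x - vbar) ^ 2) :
    ∀ t > (0 : ℝ),
      DifferentiableAt ℝ L t ∧
      deriv L t ≤ (2 / η) * ρmin * v'max * L t ∧
      (2 / η) * ρmin * v'max * L t ≤ 0 := by
  obtain rfl : β = fun t => b + vbar * t := funext hβ
  obtain rfl : L = fun t => ∫ x in (b + vbar * t - η)..(b + vbar * t), (V t x - vbar) ^ 2 :=
    funext hL
  have hρ0 : Continuous fun p : ℝ × ℝ => ρ (max p.1 0) p.2 :=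
    continuousOn_univ.1 <| hρreg.continuousOn.comp (f := fun p : ℝ × ℝ => (max p.1 0, p.2))
      (by fun_prop) fun p _ => mk_mem_prod (mem_Ici.2 (le_max_right _ _)) (mem_univ _)
  have hρc : ∀ t ≥ (0 : ℝ), Continuous (ρ t) := fun t ht => by
    simpa [Function.comp_def, max_eq_left ht] using
      hρ0.comp (by fun_prop : Continuous fun x : ℝ => (t, x))
  have hvd : ∀ r ∈ Icc (0 : ℝ) ρmax, DifferentiableAt ℝ v r := fun r hr =>
    differentiableAt_of_deriv_ne_zero (hv' r hr).ne
  have hv'c : ContinuousOn (deriv v) (Icc 0 ρmax) :=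
    (hv.continuousOn_derivWithin (uniqueDiffOn_Icc hρmax) (by norm_num)).congr fun r hr =>
      ((hvd r hr).derivWithin (uniqueDiffOn_Icc hρmax r hr)).symm
  have hA : ∀ t ≥ (0 : ℝ), ∀ x, (1 / η) * ∫ y in x..(x + η), ρ t y ∈ Icc 0 ρmax :=
    fun t ht x => Icc_subset_Icc_left hρmin.le <|
      forward_average_mem_Icc (hρc t ht) hη (hρrange t ht) x
  have hVd : ∀ t > 0, Differentiable ℝ (V t) := by
    intro t ht x
    rw [show V t = v ∘ fun x => (1 / η) * ∫ y in x..(x + η), ρ t y from funext (hV t)]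
    exact (hvd _ (hA t ht.le x)).comp x
      ((differentiable_forward_average (hρc t ht.le) x η).const_mul _)
  have hpde' : ∀ t > 0, ∀ x,
      deriv (fun s => ρ s x) t + deriv (fun y => ρ t y * V t y) x = 0 := by
    intro t ht x
    rw [← derivWithin_of_mem_nhds (Ici_mem_nhds ht)]
    exact hpde t ht.le x
  have hVfar : ∀ t ≥ (0 : ℝ), ∀ x, b + vbar * t ≤ x → V t x = vbar := by
    intro t ht x hx
    rw [hV, hvbar, integral_congr (g := fun _ => ρbar)]
    · simp [hη.ne']
    · intro y hy
      rw [uIcc_of_le (by linarith)] at hy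
      exact hρeq t ht y (hx.trans hy.1)
  set W : ℝ → ℝ → ℝ := fun t y =>
    (1 / η) * ∫ z in (b + vbar * t + y)..(b + vbar * t + y + η), ρ t z with hWdef
  have hVW : ∀ t y, V t (b + vbar * t + y) = v (W t y) := fun t y => hV t _
  have hWmem : ∀ t > 0, ∀ y, W t y ∈ Icc 0 ρmax := fun t ht y => hA t ht.le _
  have hWd : ∀ t > 0, ∀ y ∈ Icc (-η) 0, HasDerivAt (fun s => W s y)
      ((1 / η) * (ρ t (b + vbar * t + y) * (v (W t y) - vbar))) t := by
    intro t ht y hy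
    rw [← hVW]
    exact (hasDerivAt_moving_average (hρreg.mono (prod_mono_left Ioi_subset_Ici_self)) hVd hpde'
      ht (hVfar t ht.le _ (by linarith [hy.1]))).const_mul _
  have hWc : ContinuousOn (fun p : ℝ × ℝ => W p.1 p.2) (Ioi 0 ×ˢ univ) := by
    have h : Continuous fun p : ℝ × ℝ =>
        (1 / η) * ∫ z in (0 : ℝ)..η, ρ (max p.1 0) (b + vbar * p.1 + p.2 + z) :=
      continuous_const.mul <| continuous_parametric_intervalIntegral_of_continuous'
        (f := fun (p : ℝ × ℝ) z => ρ (max p.1 0) (b + vbar * p.1 + p.2 + z)) (hρ0.comp (by fun_prop : Continuous fun q : (ℝ × ℝ) × ℝ =>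
          (q.1.1, b + vbar * q.1.1 + q.1.2 + q.2))) 0 η
    refine h.continuousOn.congr fun p hp => ?_
    simp only [hWdef, forward_average_eq, max_eq_left (mem_Ioi.1 hp.1).le]
  have hvWc : ContinuousOn (fun p : ℝ × ℝ => v (W p.1 p.2)) (Ioi 0 ×ˢ univ) :=
    hv.continuousOn.comp hWc fun p hp => hWmem _ hp.1 _
  have hv'Wc : ContinuousOn (fun p : ℝ × ℝ => deriv v (W p.1 p.2)) (Ioi 0 ×ˢ univ) :=
    hv'c.comp hWc fun p hp => hWmem _ hp.1 _
  have hρmove : ContinuousOn (fun p : ℝ × ℝ => ρ p.1 (b + vbar * p.1 + p.2)) (Ioi 0 ×ˢ univ) :=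
    hρreg.continuousOn.comp (f := fun p : ℝ × ℝ => (p.1, b + vbar * p.1 + p.2)) (by fun_prop)
      fun p hp => mk_mem_prod (mem_Ici.2 (mem_Ioi.1 hp.1).le) (mem_univ _)
  have hηle : -η ≤ 0 := by linarith
  set F' : ℝ → ℝ → ℝ := fun t y => 2 * (v (W t y) - vbar) *
    (deriv v (W t y) * ((1 / η) * (ρ t (b + vbar * t + y) * (v (W t y) - vbar)))) with hF'def
  have hF'c : ContinuousOn (fun p : ℝ × ℝ => F' p.1 p.2) (Ioi 0 ×ˢ univ) := by
    have h := hvWc.sub (continuousOn_const (c := vbar))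
    exact (continuousOn_const.mul h).mul (hv'Wc.mul (continuousOn_const.mul (hρmove.mul h)))
  have hslice : ∀ {f : ℝ → ℝ → ℝ}, ContinuousOn (fun p : ℝ × ℝ => f p.1 p.2) (Ioi 0 ×ˢ univ) →
      ∀ t > 0, Continuous (f t) := fun hf t ht => continuousOn_univ.1 <|
    hf.comp (f := fun x => (t, x)) (by fun_prop) fun x _ => ⟨ht, mem_univ _⟩
  have hFc : ∀ t > 0, Continuous fun y => (v (W t y) - vbar) ^ 2 := fun t ht =>
    ((hslice (f := fun t y => v (W t y)) hvWc t ht).sub continuous_const).pow 2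
  have hLW : ∀ t, ∫ x in (b + vbar * t - η)..(b + vbar * t), (V t x - vbar) ^ 2
      = ∫ y in (-η)..0, (v (W t y) - vbar) ^ 2 := by
    intro t
    simp only [← hVW]
    rw [integral_comp_add_left (fun x => (V t x - vbar) ^ 2)]
    simp [sub_eq_add_neg]
  simp only [hLW]
  intro t ht
  have hLd : HasDerivAt (fun t => ∫ y in (-η)..0, (v (W t y) - vbar) ^ 2)
      (∫ y in (-η)..0, F' t y) t := by
    refine hasDerivAt_intervalIntegral_of_continuousOn isOpen_Ioi ht
      (fun s hs => (hFc s hs).continuousOn) (hF'c.mono (prod_mono_right (subset_univ _))) ?_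
    intro s hs y hy
    rw [uIcc_of_le hηle] at hy
    have h := (((hvd _ (hWmem s hs y)).hasDerivAt.comp s (hWd s hs y hy)).sub_const vbar).fun_pow 2
    simpa [hF'def] using h
  refine ⟨hLd.differentiableAt, ?_, ?_⟩
  · rw [hLd.deriv, ← intervalIntegral.integral_const_mul]
    refine integral_mono_on hηle ((hslice hF'c t ht).intervalIntegrable _ _)
      ((continuous_const.mul (hFc t ht)).intervalIntegrable _ _) fun y _ => ?_
    have h1 := hv'bound _ (hWmem t ht y)
    have h2 := (hρrange t ht.le (b + vbar * t + y)).1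
    have h3 : ρ t (b + vbar * t + y) * deriv v (W t y) ≤ ρmin * v'max := by
      nlinarith
    calc F' t y = (2 / η) * (v (W t y) - vbar) ^ 2
          * (ρ t (b + vbar * t + y) * deriv v (W t y)) := by simp only [hF'def]; ring
      _ ≤ (2 / η) * (v (W t y) - vbar) ^ 2 * (ρmin * v'max) := by gcongr
      _ = _ := by ring
  · refine mul_nonpos_of_nonpos_of_nonneg
      (mul_nonpos_of_nonneg_of_nonpos (by positivity) hv'max.le) ?_
    exact integral_nonneg hηle fun y _ => sq_nonneg _
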